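/- Let F be a generalized isotropic Berwald metric with data (μ, λ) of isotropic flag curvature, i.e. of scalar flag curvature with K = K(x) independent of y. If 2μ' − (μ² + 4K)F ≠ 0 at every point of U × (ℝ^n ∖ {0}), where μ' := μ_{|s} y^s, then the mean Cartan torsion vanishes identically (I_k = 0), so that F reduces to a Riemannian metric. -/

import Mathlib

/-!  Common setup: Finsler metrics on an open set `U ⊆ ℝⁿ`, in coordinates. -/

noncomputable section

open scoped BigOperators

/-- Points/vectors of `ℝⁿ`, as functions `Fin n → ℝ`. -/
abbrev Pt (n : ℕ) := Fin n → ℝ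

variable {n : ℕ}

/-- Partial derivative in the fiber variable `y`, direction `yⁱ`. -/
def pdy (f : Pt n → Pt n → ℝ) (i : Fin n) : Pt n → Pt n → ℝ :=
  fun x y => fderiv ℝ (fun y' => f x y') y (Pi.single i 1)

/-- Partial derivative in the base variable `x`, direction `xⁱ`. -/
def pdx (f : Pt n → Pt n → ℝ) (i : Fin n) : Pt n → Pt n → ℝ :=
  fun x y => fderiv ℝ (fun x' => f x' y) x (Pi.single i 1)

/-- `F²`. -/
def F2 (F : Pt n → Pt n → ℝ) : Pt n → Pt n → ℝ := fun x y => (F x y) ^ 2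

/-- Fundamental tensor `g_{ij} = (1/2) ∂²(F²)/∂yⁱ∂yʲ`. -/
def gLow (F : Pt n → Pt n → ℝ) (i j : Fin n) : Pt n → Pt n → ℝ :=
  fun x y => (1 / 2 : ℝ) * pdy (pdy (F2 F) j) i x y

/-- The fundamental tensor as a matrix. -/
def gMat (F : Pt n → Pt n → ℝ) (x y : Pt n) : Matrix (Fin n) (Fin n) ℝ :=
  Matrix.of fun i j => gLow F i j x y

/-- Inverse fundamental tensor `g^{ij}`. -/
def gInv (F : Pt n → Pt n → ℝ) (i j : Fin n) : Pt n → Pt n → ℝ :=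
  fun x y => (gMat F x y)⁻¹ i j

/-- Lowered fiber variable `y_i := g_{ij} yʲ`. -/
def yLow (F : Pt n → Pt n → ℝ) (i : Fin n) : Pt n → Pt n → ℝ :=
  fun x y => ∑ j, gLow F i j x y * y j

/-- `ℓⁱ := yⁱ / F`. -/
def ell (F : Pt n → Pt n → ℝ) (i : Fin n) : Pt n → Pt n → ℝ :=
  fun x y => y i / F x y

/-- Angular metric `h_{ij} := g_{ij} - F⁻² y_i y_j`. -/
def hLow (F : Pt n → Pt n → ℝ) (i j : Fin n) : Pt n → Pt n → ℝ :=
  fun x y => gLow F i j x y - yLow F i x y * yLow F j x y / (F x y) ^ 2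

/-- `hⁱ_j := δⁱ_j - F⁻² yⁱ y_j`. -/
def hUp (F : Pt n → Pt n → ℝ) (i j : Fin n) : Pt n → Pt n → ℝ :=
  fun x y => (if i = j then (1 : ℝ) else 0) - y i * yLow F j x y / (F x y) ^ 2

/-- Cartan torsion `C_{ijk} := (1/4) ∂³(F²)/∂yⁱ∂yʲ∂yᵏ`. -/
def Cartan (F : Pt n → Pt n → ℝ) (i j k : Fin n) : Pt n → Pt n → ℝ :=
  fun x y => (1 / 4 : ℝ) * pdy (pdy (pdy (F2 F) k) j) i x y

/-- Mean Cartan torsion `I_k := g^{ij} C_{ijk}`. -/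
def mCartan (F : Pt n → Pt n → ℝ) (k : Fin n) : Pt n → Pt n → ℝ :=
  fun x y => ∑ i, ∑ j, gInv F i j x y * Cartan F i j k x y

/-- Spray coefficients `Gⁱ`. -/
def Gspray (F : Pt n → Pt n → ℝ) (i : Fin n) : Pt n → Pt n → ℝ :=
  fun x y => (1 / 4 : ℝ) * ∑ l, gInv F i l x y *
    ((∑ k, y k * pdx (pdy (F2 F) l) k x y) - pdx (F2 F) l x y)

/-- Berwald curvature `Bⁱ_{jkl} := ∂³Gⁱ/∂yʲ∂yᵏ∂yˡ`. -/
def Bcurv (F : Pt n → Pt n → ℝ) (i j k l : Fin n) : Pt n → Pt n → ℝ :=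
  pdy (pdy (pdy (Gspray F i) l) k) j

/-- Mean Berwald curvature `E_{jk} := (1/2) Bᵐ_{jkm}`. -/
def Ecurv (F : Pt n → Pt n → ℝ) (j k : Fin n) : Pt n → Pt n → ℝ :=
  fun x y => (1 / 2 : ℝ) * ∑ m, Bcurv F m j k m x y

/-- Nonlinear connection `Nⁱ_j := ∂Gⁱ/∂yʲ`. -/
def Ncon (F : Pt n → Pt n → ℝ) (i j : Fin n) : Pt n → Pt n → ℝ :=
  pdy (Gspray F i) j

/-- Berwald connection coefficients `Γⁱ_{jk} := ∂²Gⁱ/∂yʲ∂yᵏ`. -/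
def Γcon (F : Pt n → Pt n → ℝ) (i j k : Fin n) : Pt n → Pt n → ℝ :=
  pdy (pdy (Gspray F i) k) j

/-- Horizontal (Berwald) covariant derivative of a scalar. -/
def hD0 (F : Pt n → Pt n → ℝ) (f : Pt n → Pt n → ℝ) (m : Fin n) : Pt n → Pt n → ℝ :=
  fun x y => pdx f m x y - ∑ r, Ncon F r m x y * pdy f r x y

/-- Horizontal covariant derivative of a covariant 2-tensor. -/
def hD2 (F : Pt n → Pt n → ℝ) (T : Fin n → Fin n → Pt n → Pt n → ℝ) (j k m : Fin n) :
    Pt n → Pt n → ℝ :=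
  fun x y => hD0 F (T j k) m x y - (∑ r, T r k x y * Γcon F r j m x y)
    - ∑ r, T j r x y * Γcon F r k m x y

/-- Horizontal covariant derivative of a covariant 3-tensor. -/
def hD3 (F : Pt n → Pt n → ℝ) (T : Fin n → Fin n → Fin n → Pt n → Pt n → ℝ) (i j k m : Fin n) :
    Pt n → Pt n → ℝ :=
  fun x y => hD0 F (T i j k) m x y - (∑ r, T r j k x y * Γcon F r i m x y)
    - (∑ r, T i r k x y * Γcon F r j m x y) - ∑ r, T i j r x y * Γcon F r k m x y

/-- Horizontal covariant derivative of a (1,3)-tensor `Tⁱ_{jkl}`. -/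
def hD13 (F : Pt n → Pt n → ℝ) (T : Fin n → Fin n → Fin n → Fin n → Pt n → Pt n → ℝ)
    (i j k l m : Fin n) : Pt n → Pt n → ℝ :=
  fun x y => hD0 F (T i j k l) m x y + (∑ r, T r j k l x y * Γcon F i r m x y)
    - (∑ r, T i r k l x y * Γcon F r j m x y) - (∑ r, T i j r l x y * Γcon F r k m x y)
    - ∑ r, T i j k r x y * Γcon F r l m x y

/-- Landsberg curvature `L_{ijk} := C_{ijk|m} yᵐ`. -/
def Land (F : Pt n → Pt n → ℝ) (i j k : Fin n) : Pt n → Pt n → ℝ :=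
  fun x y => ∑ m, hD3 F (Cartan F) i j k m x y * y m

/-- Stretch curvature `Σ_{ijkl} := 2(L_{ijk|l} - L_{ijl|k})`. -/
def Stretch (F : Pt n → Pt n → ℝ) (i j k l : Fin n) : Pt n → Pt n → ℝ :=
  fun x y => 2 * (hD3 F (Land F) i j k l x y - hD3 F (Land F) i j l k x y)

/-- Douglas tensor `Dⁱ_{jkl}`. -/
def Douglas (F : Pt n → Pt n → ℝ) (i j k l : Fin n) : Pt n → Pt n → ℝ :=
  fun x y => Bcurv F i j k l x y - (2 / ((n : ℝ) + 1)) *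
    (Ecurv F j k x y * (if i = l then (1 : ℝ) else 0)
      + Ecurv F j l x y * (if i = k then (1 : ℝ) else 0)
      + Ecurv F k l x y * (if i = j then (1 : ℝ) else 0)
      + pdy (Ecurv F j k) l x y * y i)

/-- Riemann curvature `Rⁱ_k`. -/
def RiemK (F : Pt n → Pt n → ℝ) (i k : Fin n) : Pt n → Pt n → ℝ :=
  fun x y => 2 * pdx (Gspray F i) k x y - (∑ j, y j * pdx (pdy (Gspray F i) k) j x y)
    + 2 * (∑ j, Gspray F j x y * Γcon F i j k x y) - ∑ j, Ncon F i j x y * Ncon F j k x y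

/-- `Rⁱ_{jkl} := (1/3) ∂/∂yʲ (∂Rⁱ_k/∂yˡ - ∂Rⁱ_l/∂yᵏ)`. -/
def Riem4 (F : Pt n → Pt n → ℝ) (i j k l : Fin n) : Pt n → Pt n → ℝ :=
  fun x y => (1 / 3 : ℝ) *
    pdy (fun x' y' => pdy (RiemK F i k) l x' y' - pdy (RiemK F i l) k x' y') j x y

/-- `F` is R-quadratic on `U`: `Rⁱ_{jkl}(x,y)` is independent of `y`. -/
def RQuadratic (U : Set (Pt n)) (F : Pt n → Pt n → ℝ) : Prop :=
  ∀ x ∈ U, ∀ y y' : Pt n, y ≠ 0 → y' ≠ 0 →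
    ∀ i j k l, Riem4 F i j k l x y = Riem4 F i j k l x y'

/-- A Finsler metric on a connected open set `U ⊆ ℝⁿ` (`n ≥ 2`). -/
structure IsFinslerMetric (U : Set (Pt n)) (F : Pt n → Pt n → ℝ) : Prop where
  dim : 2 ≤ n
  isOpen : IsOpen U
  connected : IsConnected U
  smooth : ContDiffOn ℝ (⊤ : ℕ∞) (Function.uncurry F) (U ×ˢ {y : Pt n | y ≠ 0})
  pos : ∀ x ∈ U, ∀ y : Pt n, y ≠ 0 → 0 < F x y
  homog : ∀ x ∈ U, ∀ y : Pt n, y ≠ 0 → ∀ t : ℝ, 0 < t → F x (t • y) = t * F x y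
  posdef : ∀ x ∈ U, ∀ y : Pt n, y ≠ 0 → (gMat F x y).PosDef

/-- `F` is a generalized isotropic Berwald metric on `U` with data `(μ, λ)`. -/
structure IsGIB (U : Set (Pt n)) (F μ lam : Pt n → Pt n → ℝ) : Prop where
  finsler : IsFinslerMetric U F
  smooth_mu : ContDiffOn ℝ (⊤ : ℕ∞) (Function.uncurry μ) (U ×ˢ {y : Pt n | y ≠ 0})
  smooth_lam : ContDiffOn ℝ (⊤ : ℕ∞) (Function.uncurry lam) (U ×ˢ {y : Pt n | y ≠ 0})
  homog_mu : ∀ x ∈ U, ∀ y : Pt n, y ≠ 0 → ∀ t : ℝ, 0 < t → μ x (t • y) = μ x y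
  homog_lam : ∀ x ∈ U, ∀ y : Pt n, y ≠ 0 → ∀ t : ℝ, 0 < t → lam x (t • y) = t⁻¹ * lam x y
  berwald : ∀ x ∈ U, ∀ y : Pt n, y ≠ 0 → ∀ i j k l,
    Bcurv F i j k l x y = μ x y * Cartan F j k l x y * ell F i x y
      + lam x y * (hUp F i j x y * hLow F k l x y + hUp F i k x y * hLow F j l x y
        + hUp F i l x y * hLow F j k x y)

end

/-- `F` is of scalar flag curvature with flag curvature function `K`. -/
def IsScalarFlagCurv {n : ℕ} (U : Set (Pt n)) (F K : Pt n → Pt n → ℝ) : Prop :=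
  ContDiffOn ℝ (⊤ : ℕ∞) (Function.uncurry K) (U ×ˢ {y : Pt n | y ≠ 0}) ∧
  ∀ x ∈ U, ∀ y : Pt n, y ≠ 0 → ∀ i k : Fin n,
    RiemK F i k x y = K x y * (F x y) ^ 2 * hUp F i k x y

theorem two_mul_cancel_of_algebra {A : Type*} [CommRing A] [Algebra ℝ A] {a b : A} (h : 2 * a = 2 * b) : a = b := by
  have h' : (2 : ℝ) • a = (2 : ℝ) • b := by
    rwa [ofNat_smul_eq_nsmul ℝ, ofNat_smul_eq_nsmul ℝ, nsmul_eq_mul, nsmul_eq_mul]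
  simpa [smul_smul] using congrArg (fun z => (2⁻¹ : ℝ) • z) h'

theorem three_mul_cancel_of_algebra {A : Type*} [CommRing A] [Algebra ℝ A] {a b : A} (h : 3 * a = 3 * b) : a = b := by
  have h' : (3 : ℝ) • a = (3 : ℝ) • b := by
    rwa [ofNat_smul_eq_nsmul ℝ, ofNat_smul_eq_nsmul ℝ, nsmul_eq_mul, nsmul_eq_mul]
  simpa [smul_smul] using congrArg (fun z => (3⁻¹ : ℝ) • z) h'

namespace Derivation

variable {A : Type*} [CommRing A] [Algebra ℝ A]

theorem map_two (D : Derivation ℝ A A) : D 2 = 0 := by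
  simpa using D.map_natCast 2

theorem map_mul_eq (D : Derivation ℝ A A) (a b : A) : D (a * b) = D a * b + a * D b := by
  rw [D.leibniz, smul_eq_mul, smul_eq_mul]; ring

theorem matrix_map_mul {ι : Type*} [Fintype ι] (D : Derivation ℝ A A) (M N : Matrix ι ι A) :
    (M * N).map D = M.map D * N + M * N.map D := by
  ext i j
  simp only [Matrix.mul_apply, Matrix.map_apply, Matrix.add_apply, map_sum, map_mul_eq,
    Finset.sum_add_distrib]

theorem matrix_map_add {ι : Type*} (D : Derivation ℝ A A) (M N : Matrix ι ι A) :
    (M + N).map D = M.map D + N.map D := by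
  ext i j; simp

theorem matrix_map_neg {ι : Type*} (D : Derivation ℝ A A) (M : Matrix ι ι A) :
    (-M).map D = -M.map D := by
  ext i j; simp

theorem matrix_map_smul {ι : Type*} (D : Derivation ℝ A A) (a : A) (M : Matrix ι ι A) :
    (a • M).map D = D a • M + a • M.map D := by
  ext i j; simp [Derivation.leibniz, add_comm, mul_comm]

theorem matrix_map_sum {ι : Type*} [Fintype ι] (D : Derivation ℝ A A) (M : ι → Matrix ι ι A) :
    (∑ r, M r).map D = ∑ r, (M r).map D := by
  ext i j; simp [Matrix.sum_apply]

end Derivation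

/-- The algebra underlying local Finsler geometry: commuting horizontal and vertical derivations
of a ring of functions, the fiber coordinates `y`, and the energy `E = F² / 2`, which is
homogeneous of degree two and has a nondegenerate vertical Hessian. -/
structure FinslerCalculus (A ι : Type*) [CommRing A] [Algebra ℝ A] [Fintype ι]
    [DecidableEq ι] where
  dx : ι → Derivation ℝ A A
  dy : ι → Derivation ℝ A A
  y : ι → A
  E : A
  dx_dx : ∀ i j a, dx i (dx j a) = dx j (dx i a)
  dy_dy : ∀ i j a, dy i (dy j a) = dy j (dy i a)
  dx_dy : ∀ i j a, dx i (dy j a) = dy j (dx i a)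
  dx_y : ∀ i j, dx i (y j) = 0
  dy_y : ∀ i j, dy i (y j) = if i = j then 1 else 0
  euler_E : ∑ j, y j * dy j E = 2 * E
  isUnit_det : IsUnit (Matrix.of fun i j => dy i (dy j E)).det

namespace FinslerCalculus

open Matrix Derivation

variable {A ι : Type*} [CommRing A] [Algebra ℝ A] [Fintype ι] [DecidableEq ι]
  (C : FinslerCalculus A ι)

/-- The fundamental tensor. -/
def g : Matrix ι ι A := Matrix.of fun i j => C.dy i (C.dy j C.E)

/-- The spray coefficients. -/
noncomputable def G (i : ι) : A := (1 / 2 : ℝ) • ∑ l, C.g⁻¹ i l *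
  (∑ k, C.y k * C.dx k (C.dy l C.E) - C.dx l C.E)

/-- The spray, as a derivation. -/
noncomputable def S : Derivation ℝ A A := ∑ k, C.y k • C.dx k - ∑ r, (2 * C.G r) • C.dy r

theorem S_apply (a : A) :
    C.S a = ∑ k, C.y k * C.dx k a - ∑ r, 2 * C.G r * C.dy r a := by
  simp only [S, Derivation.sub_apply, ← Derivation.coeFnAddMonoidHom_apply, map_sum,
    Finset.sum_apply]
  simp

/-- The nonlinear connection. -/
noncomputable def N : Matrix ι ι A := Matrix.of fun r i => C.dy i (C.G r)

/-- The vertical derivatives of the fundamental tensor (twice the Cartan torsion). -/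
def c (j : ι) : Matrix ι ι A := C.g.map (C.dy j)

/-- The Berwald connection. -/
noncomputable def Γ (j : ι) : Matrix ι ι A := C.N.map (C.dy j)

theorem N_apply (r i : ι) : C.N r i = C.dy i (C.G r) := rfl

theorem g_apply (i j : ι) : C.g i j = C.dy i (C.dy j C.E) := rfl

theorem isUnit_det_g : IsUnit C.g.det := C.isUnit_det

theorem c_apply (j k l : ι) : C.c j k l = C.dy j (C.g k l) := rfl

theorem Γ_apply (j r k : ι) : C.Γ j r k = C.dy j (C.N r k) := rfl

theorem g_symm (i j : ι) : C.g i j = C.g j i := C.dy_dy _ _ _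

theorem Γ_symm (j r k : ι) : C.Γ j r k = C.Γ k r j := C.dy_dy _ _ _

theorem c_symm₁ (j k l : ι) : C.c j k l = C.c k j l := C.dy_dy _ _ _

theorem c_symm₂ (j k l : ι) : C.c j k l = C.c j l k := congrArg _ (C.g_symm k l)

theorem dy_S (i : ι) (a : A) :
    C.dy i (C.S a) = C.S (C.dy i a) + C.dx i a - 2 * ∑ r, C.N r i * C.dy r a := by
  simp only [S_apply, map_sub, map_sum, map_mul_eq, map_two, C.dy_y, ← C.dx_dy, N_apply,
    C.dy_dy i, Finset.sum_add_distrib, Finset.mul_sum, ite_mul, one_mul, zero_mul,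
    Finset.sum_ite_eq, Finset.mem_univ, if_true, zero_add]
  simp only [mul_assoc]
  ring

theorem dx_S (i : ι) (a : A) :
    C.dx i (C.S a) = C.S (C.dx i a) - 2 * ∑ r, C.dx i (C.G r) * C.dy r a := by
  simp only [S_apply, map_sub, map_sum, map_mul_eq, map_two, C.dx_y, C.dx_dx i, C.dx_dy i,
    Finset.sum_add_distrib, Finset.mul_sum, zero_mul, zero_add]
  simp only [mul_assoc]
  ring

theorem sum_g_mul_G (l : ι) :
    ∑ r, C.g l r * (2 * C.G r) = ∑ k, C.y k * C.dx k (C.dy l C.E) - C.dx l C.E := by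
  set b : ι → A := fun l => ∑ k, C.y k * C.dx k (C.dy l C.E) - C.dx l C.E
  have hG : (fun r => 2 * C.G r) = C.g⁻¹ *ᵥ b := by
    funext r
    rw [G, mul_smul_comm, two_mul, ← two_smul ℝ, smul_smul]
    norm_num [Matrix.mulVec, dotProduct, b]
  have : C.g *ᵥ (fun r => 2 * C.G r) = b := by
    rw [hG, Matrix.mulVec_mulVec, Matrix.mul_nonsing_inv _ C.isUnit_det_g, Matrix.one_mulVec]
  exact congrFun this l

theorem euler_lagrange (l : ι) :
    ∑ k, C.y k * C.dx k (C.dy l C.E) - ∑ r, 2 * C.G r * C.dy r (C.dy l C.E) = C.dx l C.E := by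
  have h : ∑ r, 2 * C.G r * C.dy r (C.dy l C.E) = ∑ r, C.g l r * (2 * C.G r) :=
    Finset.sum_congr rfl fun r _ => by rw [← g_apply, C.g_symm, mul_comm]
  rw [h, sum_g_mul_G]
  ring

theorem sum_y_mul_dy_dy (l : ι) (a : A) :
    ∑ j, C.y j * C.dy j (C.dy l a) = C.dy l (∑ j, C.y j * C.dy j a) - C.dy l a := by
  simp only [map_sum, map_mul_eq, C.dy_y, Finset.sum_add_distrib, ite_mul, one_mul,
    zero_mul, Finset.sum_ite_eq, Finset.mem_univ, if_true, C.dy_dy l]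
  ring

theorem sum_y_mul_dy_dx (l : ι) (a : A) :
    ∑ j, C.y j * C.dy j (C.dx l a) = C.dx l (∑ j, C.y j * C.dy j a) := by
  simp only [map_sum, map_mul_eq, C.dx_y, zero_mul, zero_add, C.dx_dy]

theorem euler_G (i : ι) : ∑ j, C.y j * C.dy j (C.G i) = 2 * C.G i := by
  have hE : ∀ l, ∑ j, C.y j * C.dy j (C.dy l C.E) = C.dy l C.E := fun l => by
    rw [sum_y_mul_dy_dy, C.euler_E, map_mul_eq, map_two]; ring
  have hg : ∀ l r, ∑ j, C.y j * C.dy j (C.g l r) = 0 := fun l r => by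
    rw [g_apply, sum_y_mul_dy_dy, hE, sub_self]
  have key : C.g *ᵥ (fun r => ∑ j, C.y j * C.dy j (C.G r)) = C.g *ᵥ (fun r => 2 * C.G r) := by
    funext l
    have h := Finset.sum_congr (rfl : (Finset.univ : Finset ι) = _)
      fun j _ => congrArg (fun z => C.y j * C.dy j z) (C.sum_g_mul_G l)
    have h₁ : ∑ j, C.y j * C.dy j (∑ r, C.g l r * (2 * C.G r))
        = ∑ r, (∑ j, C.y j * C.dy j (C.g l r)) * (2 * C.G r)
          + 2 * ∑ r, C.g l r * ∑ j, C.y j * C.dy j (C.G r) := by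
      simp only [map_sum, map_mul_eq, map_two, Finset.mul_sum, Finset.sum_mul,
        ← Finset.sum_add_distrib]
      rw [Finset.sum_comm]
      exact Finset.sum_congr rfl fun _ _ => Finset.sum_congr rfl fun _ _ => by ring
    have h₂ : ∑ j, C.y j * C.dy j (∑ k, C.y k * C.dx k (C.dy l C.E) - C.dx l C.E)
        = ∑ k, C.y k * C.dx k (C.dy l C.E)
          + ∑ k, C.y k * ∑ j, C.y j * C.dy j (C.dx k (C.dy l C.E))
          - ∑ j, C.y j * C.dy j (C.dx l C.E) := by
      simp only [map_sub, map_sum, map_mul_eq, C.dy_y, mul_sub, Finset.sum_sub_distrib,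
        Finset.sum_add_distrib, ite_mul, one_mul, zero_mul, Finset.sum_ite_eq, Finset.mem_univ,
        if_true, mul_add, Finset.mul_sum]
      rw [Finset.sum_comm]
      congr 2
      exact Finset.sum_congr rfl fun _ _ => Finset.sum_congr rfl fun _ _ => by ring
    simp only [h₁, h₂, hg, sum_y_mul_dy_dx, hE, zero_mul, Finset.sum_const_zero, C.euler_E,
      map_mul_eq, map_two, zero_add] at h
    apply two_mul_cancel_of_algebra
    simp only [Matrix.mulVec, dotProduct]
    rw [C.sum_g_mul_G, h]
    ring
  have hinv := congrArg (fun v => C.g⁻¹ *ᵥ v) key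
  simp only [Matrix.mulVec_mulVec, Matrix.nonsing_inv_mul _ C.isUnit_det_g,
    Matrix.one_mulVec] at hinv
  exact congrFun hinv i

theorem S_dy_E (l : ι) : C.S (C.dy l C.E) = C.dx l C.E := by
  rw [S_apply, C.euler_lagrange]

theorem sum_y_mul_g (k : ι) : ∑ j, C.y j * C.g j k = C.dy k C.E := by
  have h := congrArg (C.dy k) C.euler_E
  simp only [map_sum, map_mul_eq, map_two, C.dy_y, Finset.sum_add_distrib, ite_mul, one_mul,
    zero_mul, Finset.sum_ite_eq, Finset.mem_univ, if_true, zero_add, C.dy_dy k] at h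
  simp only [g_apply]
  linear_combination h

theorem sum_y_mul_c (k l : ι) : ∑ j, C.y j * C.c j k l = 0 := by
  have h := congrArg (C.dy k) (C.sum_y_mul_g l)
  simp only [map_sum, map_mul_eq, C.dy_y, Finset.sum_add_distrib, ite_mul, one_mul,
    zero_mul, Finset.sum_ite_eq, Finset.mem_univ, if_true] at h
  rw [← g_apply] at h
  simp only [← c_apply, C.c_symm₁ k] at h
  linear_combination h

theorem sum_y_mul_N (r : ι) : ∑ k, C.y k * C.N r k = 2 * C.G r := C.euler_G r

theorem S_g_apply (k l : ι) :
    C.S (C.g k l) = C.dx l (C.dy k C.E) - C.dx k (C.dy l C.E) + 2 * ∑ r, C.N r k * C.g r l := by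
  have h := congrArg (C.dy k) (C.S_dy_E l)
  rw [dy_S, ← C.dx_dy] at h
  simp only [← g_apply] at h
  linear_combination h

theorem dx_dy_E_sub (k l : ι) :
    C.dx l (C.dy k C.E) - C.dx k (C.dy l C.E)
      = ∑ r, C.N r l * C.g r k - ∑ r, C.N r k * C.g r l := by
  have h₁ := C.S_g_apply k l
  have h₂ := C.S_g_apply l k
  rw [C.g_symm l k] at h₂
  apply two_mul_cancel_of_algebra
  linear_combination h₂ - h₁

theorem S_g : C.g.map C.S = C.Nᵀ * C.g + C.g * C.N := by
  ext k l
  have h : ∑ r, C.g k r * C.N r l = ∑ r, C.N r l * C.g r k :=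
    Finset.sum_congr rfl fun r _ => by rw [C.g_symm k r, mul_comm]
  simp only [map_apply, Matrix.add_apply, mul_apply, transpose_apply, h]
  linear_combination C.S_g_apply k l + C.dx_dy_E_sub k l

theorem dx_E (l : ι) : C.dx l C.E = ∑ r, C.N r l * C.dy r C.E := by
  have h := Finset.sum_congr (rfl : (Finset.univ : Finset ι) = _)
    fun k _ => congrArg (C.y k * ·) (C.dx_dy_E_sub k l)
  simp only [mul_sub, Finset.sum_sub_distrib, Finset.mul_sum] at h
  have h₁ : ∑ k, C.y k * C.dx l (C.dy k C.E) = 2 * C.dx l C.E := by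
    have := congrArg (C.dx l) C.euler_E
    simpa [map_mul_eq, C.dx_y, map_two] using this
  have h₂ := C.S_dy_E l
  rw [S_apply] at h₂
  have h₃ : ∑ k, ∑ r, C.y k * (C.N r l * C.g r k) = ∑ r, C.N r l * C.dy r C.E := by
    rw [Finset.sum_comm]
    refine Finset.sum_congr rfl fun r _ => ?_
    rw [← sum_y_mul_g, Finset.mul_sum]
    exact Finset.sum_congr rfl fun k _ => by rw [C.g_symm r k]; ring
  have h₄ : ∑ k, ∑ r, C.y k * (C.N r k * C.g r l) = ∑ r, 2 * C.G r * C.g r l := by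
    rw [Finset.sum_comm]
    refine Finset.sum_congr rfl fun r _ => ?_
    rw [← sum_y_mul_N, Finset.sum_mul]
    exact Finset.sum_congr rfl fun k _ => by ring
  simp only [g_apply] at h₃ h₄ h
  linear_combination h - h₁ + h₂ + h₃ - h₄

theorem S_E : C.S C.E = 0 := by
  have : ∑ k, C.y k * C.dx k C.E = ∑ r, 2 * C.G r * C.dy r C.E := by
    simp only [dx_E, ← sum_y_mul_N, Finset.mul_sum, Finset.sum_mul]
    rw [Finset.sum_comm]
    exact Finset.sum_congr rfl fun k _ => Finset.sum_congr rfl fun r _ => by ring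
  rw [S_apply, this, sub_self]

/-- The dynamical covariant derivative of a family of bilinear forms, regarded as a covariant
`3`-tensor. -/
noncomputable def nabla (T : ι → Matrix ι ι A) (j : ι) : Matrix ι ι A :=
  (T j).map C.S - C.Nᵀ * T j - T j * C.N - ∑ r, C.N r j • T r

theorem dy_map_S (j : ι) (M : Matrix ι ι A) :
    (M.map C.S).map (C.dy j)
      = (M.map (C.dy j)).map C.S + M.map (C.dx j) - (2 : A) • ∑ r, C.N r j • M.map (C.dy r) := by
  ext k l
  simp [dy_S, Matrix.sum_apply]

theorem dx_map_S (j : ι) (M : Matrix ι ι A) :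
    (M.map C.S).map (C.dx j)
      = (M.map (C.dx j)).map C.S - (2 : A) • ∑ r, C.dx j (C.G r) • M.map (C.dy r) := by
  ext k l
  simp [dx_S, Matrix.sum_apply]

theorem nabla_c (j : ι) :
    C.nabla C.c j = -C.g.map (C.dx j) + ∑ r, C.N r j • C.c r + (C.Γ j)ᵀ * C.g + C.g * C.Γ j := by
  have h := congrArg (fun M => M.map (C.dy j)) C.S_g
  simp only [dy_map_S, matrix_map_add, matrix_map_mul, transpose_map] at h
  rw [nabla]
  change (C.c j).map C.S + _ - (2 : A) • ∑ r, C.N r j • C.c r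
    = (C.Γ j)ᵀ * C.g + C.Nᵀ * C.c j + (C.c j * C.N + C.g * C.Γ j) at h
  rw [two_smul, ← sub_eq_zero] at h
  rw [← sub_eq_zero]
  rw [← h]
  abel

theorem nabla_c_apply (j k l : ι) :
    C.nabla C.c j k l = -∑ r, C.dy r C.E * C.dy j (C.dy k (C.dy l (C.G r))) := by
  have h := congrArg (fun z => C.dy k (C.dy l z)) (C.dx_E j)
  simp only [map_sum, map_mul_eq, ← C.dx_dy, ← g_apply, Finset.sum_add_distrib, map_add] at h
  simp only [← Γ_apply, ← c_apply] at h
  rw [nabla_c]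
  simp only [Matrix.add_apply, Matrix.neg_apply, map_apply, mul_apply, transpose_apply, Matrix.sum_apply,
    Matrix.smul_apply, smul_eq_mul]
  have h₁ : ∑ r, C.dy k (C.Γ l r j) * C.dy r C.E
      = ∑ r, C.dy r C.E * C.dy j (C.dy k (C.dy l (C.G r))) :=
    Finset.sum_congr rfl fun r _ => by
      rw [C.Γ_symm, Γ_apply, C.dy_dy k j, N_apply, mul_comm]
  have h₂ : ∑ r, C.N r j * C.c r k l = ∑ r, C.N r j * C.c k l r :=
    Finset.sum_congr rfl fun r _ => by rw [C.c_symm₁, C.c_symm₂]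
  have h₃ : ∑ r, C.Γ j r k * C.g r l = ∑ r, C.Γ k r j * C.g l r :=
    Finset.sum_congr rfl fun r _ => by rw [C.Γ_symm, C.g_symm]
  have h₄ : ∑ r, C.g k r * C.Γ j r l = ∑ r, C.Γ l r j * C.g k r :=
    Finset.sum_congr rfl fun r _ => by rw [C.Γ_symm, mul_comm]
  rw [h₂, h₃, h₄, ← h₁]
  linear_combination -h

/-- The Riemann curvature. -/
noncomputable def R : Matrix ι ι A := Matrix.of fun i k =>
  2 * C.dx k (C.G i) - C.S (C.N i k) - ∑ j, C.N i j * C.N j k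

/-- The commutator of the dynamical and the horizontal covariant derivative. -/
noncomputable def X (j : ι) : Matrix ι ι A :=
  C.N.map (C.dx j) - (C.Γ j).map C.S + C.Γ j * C.N - C.N * C.Γ j

theorem nabla_nabla_c (j : ι) :
    C.nabla (C.nabla C.c) j = -(∑ r, C.R r j • C.c r) - (C.X j)ᵀ * C.g - C.g * C.X j := by
  have hS : ∀ r, (C.c r).map C.S = C.nabla C.c r + C.Nᵀ * C.c r + C.c r * C.N
      + ∑ s, C.N s r • C.c s := fun r => by rw [nabla]; abel
  have hdx := congrArg (fun M => M.map (C.dx j)) C.S_g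
  simp only [dx_map_S, matrix_map_add, matrix_map_mul, transpose_map] at hdx
  have hZ : (C.nabla C.c j).map C.S = -(C.g.map (C.dx j)).map C.S
      + (∑ r, C.S (C.N r j) • C.c r + ∑ r, C.N r j • (C.c r).map C.S)
      + (((C.Γ j).map C.S)ᵀ * C.g + (C.Γ j)ᵀ * C.g.map C.S)
      + (C.g.map C.S * C.Γ j + C.g * (C.Γ j).map C.S) := by
    rw [nabla_c]
    simp only [matrix_map_add, matrix_map_mul, matrix_map_neg, matrix_map_sum, matrix_map_smul,
      Finset.sum_add_distrib, transpose_map]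
  have hR : ∑ r, C.R r j • C.c r = (2 : A) • ∑ r, C.dx j (C.G r) • C.c r - ∑ r, C.S (C.N r j) • C.c r
      - ∑ r, C.N r j • ∑ s, C.N s r • C.c s := by
    have : ∑ r, C.N r j • ∑ s, C.N s r • C.c s = ∑ r, (∑ s, C.N r s * C.N s j) • C.c r := by
      simp only [Finset.smul_sum, Finset.sum_smul, smul_smul]
      rw [Finset.sum_comm]
      exact Finset.sum_congr rfl fun _ _ => Finset.sum_congr rfl fun _ _ => by rw [mul_comm]
    rw [this, Finset.smul_sum, ← Finset.sum_sub_distrib, ← Finset.sum_sub_distrib]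
    refine Finset.sum_congr rfl fun r _ => ?_
    simp only [R, of_apply, sub_smul, smul_smul]
  have hN : ∑ r, C.N r j • (C.c r).map C.S = ∑ r, C.N r j • C.nabla C.c r
      + C.Nᵀ * (∑ r, C.N r j • C.c r) + (∑ r, C.N r j • C.c r) * C.N
      + ∑ r, C.N r j • ∑ s, C.N s r • C.c s := by
    simp only [hS, smul_add, Finset.sum_add_distrib, Finset.mul_sum, Finset.sum_mul,
      Matrix.mul_smul, Matrix.smul_mul]
  have hT : (C.X j)ᵀ = (C.N.map (C.dx j))ᵀ - ((C.Γ j).map C.S)ᵀ + C.Nᵀ * (C.Γ j)ᵀ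
      - (C.Γ j)ᵀ * C.Nᵀ := by
    simp only [X, transpose_sub, transpose_add, transpose_mul]
  change (C.g.map (C.dx j)).map C.S - (2 : A) • ∑ r, C.dx j (C.G r) • C.c r = _ at hdx
  rw [sub_eq_iff_eq_add] at hdx
  have hnn : C.nabla (C.nabla C.c) j = (C.nabla C.c j).map C.S - C.Nᵀ * C.nabla C.c j
      - C.nabla C.c j * C.N - ∑ r, C.N r j • C.nabla C.c r := rfl
  rw [hnn, hZ, hN, hdx, C.S_g, hR, hT, X, C.nabla_c j]
  generalize ∑ r, C.N r j • C.nabla C.c r = Z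
  generalize ∑ r, C.N r j • ∑ s, C.N s r • C.c s = Y
  noncomm_ring

theorem dy_R (l i k : ι) :
    C.dy l (C.R i k) = 2 * C.dx k (C.N i l) - C.dx l (C.N i k) - C.S (C.Γ l i k)
      + 2 * (∑ r, C.N r l * C.Γ k i r) - (∑ s, C.Γ l i s * C.N s k) - ∑ s, C.N i s * C.Γ k s l := by
  have h₁ : ∑ r, C.N r l * C.dy r (C.N i k) = ∑ r, C.N r l * C.Γ k i r :=
    Finset.sum_congr rfl fun r _ => by rw [← Γ_apply, Γ_symm]
  have h₂ : ∑ s, C.N i s * C.dy l (C.N s k) = ∑ s, C.N i s * C.Γ k s l :=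
    Finset.sum_congr rfl fun r _ => by rw [← Γ_apply, Γ_symm]
  simp only [R, of_apply, map_sub, map_mul_eq, map_two, map_sum, dy_S, Finset.sum_add_distrib, h₁,
    h₂, ← C.dx_dy]
  simp only [Γ_apply, N_apply]
  ring

theorem three_mul_X (k i l : ι) :
    3 * C.X k i l = 2 * C.dy l (C.R i k) + C.dy k (C.R i l) := by
  have h₁ : ∑ s, C.Γ l i s * C.N s k = ∑ r, C.N r k * C.Γ l i r :=
    Finset.sum_congr rfl fun r _ => mul_comm _ _
  have h₂ : ∑ s, C.Γ k i s * C.N s l = ∑ r, C.N r l * C.Γ k i r :=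
    Finset.sum_congr rfl fun r _ => mul_comm _ _
  have h₃ : ∑ s, C.N i s * C.Γ l s k = ∑ s, C.N i s * C.Γ k s l :=
    Finset.sum_congr rfl fun r _ => by rw [Γ_symm]
  simp only [dy_R, X, Matrix.sub_apply, Matrix.add_apply, mul_apply, map_apply, h₁, h₂, h₃,
    C.Γ_symm l i k]
  ring

section Isotropic

variable {C} {K : A} (hK : ∀ i, C.dy i K = 0)
  (hR : ∀ i k, C.R i k = K * (2 * C.E * (if i = k then 1 else 0) - C.y i * C.dy k C.E))

include hK hR

theorem X_of_isotropic (j r k : ι) :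
    C.X j r k = K * (C.dy k C.E * (if r = j then 1 else 0) - C.y r * C.g j k) := by
  have hd : ∀ l i k, C.dy l (C.R i k) = K * (2 * C.dy l C.E * (if i = k then 1 else 0)
      - (if i = l then 1 else 0) * C.dy k C.E - C.y i * C.g l k) := by
    intro l i k
    have hite : C.dy l (if i = k then 1 else 0) = 0 := by split_ifs <;> simp
    simp only [hR, map_mul_eq, map_sub, map_two, hK, hite, C.dy_y, ← g_apply, eq_comm (a := l)]
    ring
  apply three_mul_cancel_of_algebra
  rw [three_mul_X, hd, hd, C.g_symm k j]
  ring

theorem nabla_nabla_c_of_isotropic (j : ι) :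
    C.nabla (C.nabla C.c) j = -(2 * K * C.E) • C.c j := by
  ext k l
  have h₁ : ∀ k l, ∑ r, C.X j r k * C.g r l = K * (C.dy k C.E * C.g j l - C.dy l C.E * C.g j k) := by
    intro k l
    simp only [X_of_isotropic hK hR, ← C.sum_y_mul_g l, mul_sub, sub_mul, Finset.sum_sub_distrib,
      Finset.mul_sum, Finset.sum_mul, mul_ite, ite_mul, mul_one, mul_zero, zero_mul,
      Finset.sum_ite_eq', Finset.mem_univ, if_true]
    congr 1
    · ring
    · exact Finset.sum_congr rfl fun r _ => by ring
  have h₂ : ∑ r, C.g k r * C.X j r l = ∑ r, C.X j r l * C.g r k :=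
    Finset.sum_congr rfl fun r _ => by rw [C.g_symm, mul_comm]
  have h₃ : ∑ r, C.R r j * C.c r k l = 2 * K * C.E * C.c j k l := by
    have : 2 * K * C.E * C.c j k l
        = 2 * K * C.E * C.c j k l - K * C.dy j C.E * ∑ r, C.y r * C.c r k l := by
      rw [C.sum_y_mul_c, mul_zero, sub_zero]
    rw [this]
    simp only [hR, mul_sub, sub_mul, Finset.sum_sub_distrib,
      Finset.mul_sum, mul_ite, ite_mul, mul_one, mul_zero, zero_mul,
      Finset.sum_ite_eq', Finset.mem_univ, if_true]
    congr 1
    · ring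
    · exact Finset.sum_congr rfl fun r _ => by ring
  rw [nabla_nabla_c]
  simp only [Matrix.sub_apply, Matrix.neg_apply, Matrix.sum_apply, Matrix.smul_apply, mul_apply,
    transpose_apply, smul_eq_mul, h₁, h₂, h₃]
  ring

/-- If `∇C = a C` for a scalar `a` and the flag curvature `K` is isotropic, then
`(S a + a² + K F²) C = 0`. -/
theorem mul_c_eq_zero_of_isotropic {a : A} (ha : ∀ j, C.nabla C.c j = a • C.c j) (j k l : ι) :
    (C.S a + a ^ 2 + 2 * K * C.E) * C.c j k l = 0 := by
  have h : C.nabla (fun j => a • C.c j) j = C.S a • C.c j + a • C.nabla C.c j := by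
    have h₁ : ∑ r, C.N r j • a • C.c r = a • ∑ r, C.N r j • C.c r := by
      simp only [Finset.smul_sum, smul_comm a]
    rw [nabla, matrix_map_smul, h₁, Matrix.mul_smul, Matrix.smul_mul, nabla,
      smul_sub, smul_sub, smul_sub]
    abel
  rw [← funext ha, nabla_nabla_c_of_isotropic hK hR, ha] at h
  have := congrFun (congrFun h k) l
  simp only [Matrix.add_apply, Matrix.smul_apply, smul_eq_mul] at this
  linear_combination -this

end Isotropic

/-- The algebraic form of the theorem: here `F² = 2 E` and
`Bⁱ_{jkl} = μ C_{jkl} yⁱ / F + λ (hⁱ_j h_{kl} + hⁱ_k h_{jl} + hⁱ_l h_{jk})`, with `f` the inverse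
of `F`. -/
theorem gib_mul_c_eq_zero {F f K μ lam : A} (hF : F * F = 2 * C.E) (hf : F * f = 1)
    (hK : ∀ i, C.dy i K = 0)
    (hR : ∀ i k, C.R i k = K * (2 * C.E * (if i = k then 1 else 0) - C.y i * C.dy k C.E))
    (h : ι → ι → A)
    (hB : ∀ i j k l, 2 * C.dy j (C.dy k (C.dy l (C.G i))) = μ * C.c j k l * (C.y i * f)
      + 2 * lam * (((if i = j then 1 else 0) - C.y i * C.dy j C.E * f ^ 2) * h k l
        + ((if i = k then 1 else 0) - C.y i * C.dy k C.E * f ^ 2) * h j l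
        + ((if i = l then 1 else 0) - C.y i * C.dy l C.E * f ^ 2) * h j k)) (j k l : ι) :
    (2 * C.S μ - (μ ^ 2 + 4 * K) * F) * C.c j k l = 0 := by
  have hyE : ∑ r, C.dy r C.E * C.y r = 2 * C.E := by
    rw [← C.euler_E]; exact Finset.sum_congr rfl fun _ _ => mul_comm _ _
  have hh : ∀ j, ∑ r, C.dy r C.E * ((if r = j then 1 else 0) - C.y r * C.dy j C.E * f ^ 2) = 0 := by
    intro j
    have : ∑ r, C.dy r C.E * (C.y r * C.dy j C.E * f ^ 2)
        = (∑ r, C.dy r C.E * C.y r) * (C.dy j C.E * f ^ 2) := by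
      rw [Finset.sum_mul]; exact Finset.sum_congr rfl fun _ _ => by ring
    simp only [mul_sub, Finset.sum_sub_distrib, this, hyE, ← hF, mul_ite, mul_one, mul_zero,
      Finset.sum_ite_eq', Finset.mem_univ, if_true]
    linear_combination -C.dy j C.E * (F * f + 1) * hf
  have hZ : ∀ j k l, 2 * C.nabla C.c j k l = -(μ * F) * C.c j k l := by
    intro j k l
    have h₁ : 2 * ∑ r, C.dy r C.E * C.dy j (C.dy k (C.dy l (C.G r)))
        = μ * C.c j k l * f * (∑ r, C.dy r C.E * C.y r)
        + 2 * lam * h k l *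
          ∑ r, C.dy r C.E * ((if r = j then 1 else 0) - C.y r * C.dy j C.E * f ^ 2)
        + 2 * lam * h j l *
          ∑ r, C.dy r C.E * ((if r = k then 1 else 0) - C.y r * C.dy k C.E * f ^ 2)
        + 2 * lam * h j k *
          ∑ r, C.dy r C.E * ((if r = l then 1 else 0) - C.y r * C.dy l C.E * f ^ 2) := by
      simp only [Finset.mul_sum, ← Finset.sum_add_distrib]
      refine Finset.sum_congr rfl fun r _ => ?_
      linear_combination C.dy r C.E * hB r j k l
    rw [hh, hh, hh, hyE, ← hF] at h₁
    rw [nabla_c_apply]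
    linear_combination -h₁ - μ * C.c j k l * F * hf
  have hSF : C.S F = 0 := by
    have h₁ := congrArg C.S hF
    rw [map_mul_eq, map_mul_eq, S_E, map_two] at h₁
    apply two_mul_cancel_of_algebra
    linear_combination f * h₁ - 2 * C.S F * hf
  obtain ⟨a, ha'⟩ : ∃ a : A, 2 * a = -(μ * F) := by
    refine ⟨(2⁻¹ : ℝ) • -(μ * F), ?_⟩
    rw [mul_smul_comm, two_mul, ← two_smul ℝ, smul_smul]
    norm_num
  have hSa : 2 * C.S a = -(C.S μ * F) := by
    have h₁ := congrArg C.S ha'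
    rw [map_mul_eq, map_neg, map_mul_eq, map_two, hSF] at h₁
    linear_combination h₁
  have key := mul_c_eq_zero_of_isotropic (a := a) hK hR (fun j => by
    ext k l
    apply two_mul_cancel_of_algebra
    rw [hZ, Matrix.smul_apply, smul_eq_mul, ← ha']
    ring) j k l
  linear_combination (-4 * f) * key + 2 * f * C.c j k l * hSa + f * C.c j k l * (2 * a - μ * F) * ha'
    - 4 * f * K * C.c j k l * hF - (2 * C.S μ - μ ^ 2 * F - 4 * K * F) * C.c j k l * hf

end FinslerCalculus

/-- The algebra of smooth functions on a subset `Ω` of a normed space. -/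
def SmoothFun {V : Type*} [NormedAddCommGroup V] [NormedSpace ℝ V] (Ω : Set V) :
    Subalgebra ℝ (Ω → ℝ) where
  carrier := {f | ∃ φ : V → ℝ, ContDiffOn ℝ (⊤ : ℕ∞) φ Ω ∧ ∀ p : Ω, f p = φ p}
  mul_mem' := by
    rintro _ _ ⟨φ, hφ, h⟩ ⟨ψ, hψ, h'⟩
    exact ⟨fun p => φ p * ψ p, hφ.mul hψ, fun p => by simp [h, h']⟩
  add_mem' := by
    rintro _ _ ⟨φ, hφ, h⟩ ⟨ψ, hψ, h'⟩
    exact ⟨fun p => φ p + ψ p, hφ.add hψ, fun p => by simp [h, h']⟩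
  algebraMap_mem' := fun r => ⟨fun _ => r, contDiffOn_const, fun _ => rfl⟩

namespace SmoothFun

variable {V : Type*} [NormedAddCommGroup V] [NormedSpace ℝ V] {Ω : Set V}

/-- Restriction of a function which is smooth on `Ω`. -/
def mk (φ : V → ℝ) (hφ : ContDiffOn ℝ (⊤ : ℕ∞) φ Ω) : SmoothFun Ω :=
  ⟨fun p => φ p, φ, hφ, fun _ => rfl⟩

/-- Evaluation at a point. -/
def eval (p : Ω) : SmoothFun Ω →ₐ[ℝ] ℝ := (Pi.evalAlgHom ℝ (fun _ : Ω => ℝ) p).comp (SmoothFun Ω).val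

theorem eval_mk (φ : V → ℝ) (hφ : ContDiffOn ℝ (⊤ : ℕ∞) φ Ω) (p : Ω) : eval p (mk φ hφ) = φ p :=
  rfl

theorem ext_eval {a b : SmoothFun Ω} (h : ∀ p, eval p a = eval p b) : a = b :=
  Subtype.ext (funext h)

theorem isUnit_of_eval_ne_zero {a : SmoothFun Ω} (h : ∀ p, eval p a ≠ 0) : IsUnit a := by
  obtain ⟨φ, hφ, ha⟩ := a.2
  refine IsUnit.of_mul_eq_one (mk (fun p => (φ p)⁻¹) (hφ.inv fun p hp => ?_)) (ext_eval fun p => ?_)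
  · rw [← ha ⟨p, hp⟩]; exact h ⟨p, hp⟩
  · rw [map_mul, eval_mk, ← ha p, map_one]
    exact mul_inv_cancel₀ (h p)

/-- An extension to the whole space. -/
noncomputable def extend (a : SmoothFun Ω) : V → ℝ := a.2.choose

theorem contDiffOn_extend (a : SmoothFun Ω) : ContDiffOn ℝ (⊤ : ℕ∞) (extend a) Ω :=
  a.2.choose_spec.1

theorem extend_apply (a : SmoothFun Ω) (p : Ω) : (extend a) p = eval p a :=
  (a.2.choose_spec.2 p).symm

theorem contDiffOn_of_eval_eq {a : SmoothFun Ω} {φ : V → ℝ} (h : ∀ p, eval p a = φ p) :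
    ContDiffOn ℝ (⊤ : ℕ∞) φ Ω :=
  (contDiffOn_extend a).congr fun p hp => by rw [← h ⟨p, hp⟩, ← extend_apply]

theorem differentiableAt_of_eval_eq (hΩ : IsOpen Ω) {a : SmoothFun Ω} {φ : V → ℝ}
    (h : ∀ p, eval p a = φ p) (p : Ω) : DifferentiableAt ℝ φ p :=
  ((contDiffOn_of_eval_eq h).contDiffAt (hΩ.mem_nhds p.2)).differentiableAt (by simp)

theorem fderiv_extend (hΩ : IsOpen Ω) {a : SmoothFun Ω} {φ : V → ℝ} (h : ∀ p, eval p a = φ p)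
    (p : Ω) : fderiv ℝ (extend a) p = fderiv ℝ φ p :=
  Filter.EventuallyEq.fderiv_eq <| by
    filter_upwards [hΩ.mem_nhds p.2] with q hq
    rw [← h ⟨q, hq⟩, ← extend_apply]

/-- The directional derivative, as a derivation of the algebra of smooth functions. -/
noncomputable def dirDeriv (hΩ : IsOpen Ω) (v : V) : Derivation ℝ (SmoothFun Ω) (SmoothFun Ω) :=
  Derivation.mk'
    { toFun := fun a => mk (fun p => fderiv ℝ (extend a) p v)
        ((((contDiffOn_extend a).fderiv_of_isOpen hΩ (m := (⊤ : ℕ∞)) (by simp)).clm_apply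
          contDiffOn_const))
      map_add' := fun a b => ext_eval fun p => by
        have h : ∀ p, eval p (a + b) = ((extend a) + (extend b)) p := fun p => by
          rw [map_add, Pi.add_apply, extend_apply, extend_apply]
        rw [map_add, eval_mk, eval_mk, eval_mk, fderiv_extend hΩ h,
          fderiv_add (differentiableAt_of_eval_eq hΩ (fun p => (extend_apply a p).symm) p)
            (differentiableAt_of_eval_eq hΩ (fun p => (extend_apply b p).symm) p)]
        rfl
      map_smul' := fun r a => ext_eval fun p => by
        have h : ∀ p, eval p (r • a) = (r • (extend a)) p := fun p => by
          rw [map_smul, Pi.smul_apply, extend_apply]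
        rw [RingHom.id_apply, map_smul, eval_mk, eval_mk, fderiv_extend hΩ h,
          fderiv_const_smul (differentiableAt_of_eval_eq hΩ (fun p => (extend_apply a p).symm) p)]
        rfl }
    fun a b => ext_eval fun p => by
      have h : ∀ p, eval p (a * b) = ((extend a) * (extend b)) p := fun p => by
        rw [map_mul, Pi.mul_apply, extend_apply, extend_apply]
      simp only [LinearMap.coe_mk, AddHom.coe_mk, smul_eq_mul, map_add, map_mul, eval_mk]
      rw [fderiv_extend hΩ h,
          fderiv_mul (differentiableAt_of_eval_eq hΩ (fun p => (extend_apply a p).symm) p)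
            (differentiableAt_of_eval_eq hΩ (fun p => (extend_apply b p).symm) p)]
      simp [extend_apply]

theorem eval_dirDeriv (hΩ : IsOpen Ω) (v : V) {a : SmoothFun Ω} {φ : V → ℝ}
    (h : ∀ p, eval p a = φ p) (p : Ω) : eval p (dirDeriv hΩ v a) = fderiv ℝ φ p v := by
  rw [← fderiv_extend hΩ h]; rfl

theorem dirDeriv_comm (hΩ : IsOpen Ω) (v w : V) (a : SmoothFun Ω) :
    dirDeriv hΩ v (dirDeriv hΩ w a) = dirDeriv hΩ w (dirDeriv hΩ v a) := by
  refine ext_eval fun p => ?_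
  have key : ∀ v w, eval p (dirDeriv hΩ v (dirDeriv hΩ w a))
      = fderiv ℝ (fderiv ℝ (extend a)) p v w := by
    intro v w
    rw [eval_dirDeriv hΩ v (φ := fun q => fderiv ℝ (extend a) q w) (fun _ => rfl)]
    have hd : DifferentiableAt ℝ (fderiv ℝ (extend a)) p :=
      (((contDiffOn_extend a).fderiv_of_isOpen hΩ (m := (⊤ : ℕ∞)) (by simp)).contDiffAt
        (hΩ.mem_nhds p.2)).differentiableAt (by simp)
    rw [fderiv_clm_apply hd (differentiableAt_const w)]
    simp
  rw [key, key]
  exact (((contDiffOn_extend a).contDiffAt (hΩ.mem_nhds p.2)).isSymmSndFDerivAt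
    (by simpa using WithTop.coe_le_coe.2 (le_top : (2 : ℕ∞) ≤ ⊤))).eq v w

end SmoothFun

section Slit

variable {n : ℕ} {U : Set (Pt n)}

/-- The slit tangent bundle over `U`. -/
def slit (U : Set (Pt n)) : Set (Pt n × Pt n) := U ×ˢ {y : Pt n | y ≠ 0}

theorem isOpen_slit (hU : IsOpen U) : IsOpen (slit U) :=
  hU.prod isOpen_ne

/-- The element `a` of the algebra of smooth functions is represented by `f`. -/
def Represents (a : SmoothFun (slit U)) (f : Pt n → Pt n → ℝ) : Prop :=
  ∀ p : slit U, SmoothFun.eval p a = Function.uncurry f p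

namespace Represents

open SmoothFun

theorem mk {f : Pt n → Pt n → ℝ}
    (hf : ContDiffOn ℝ (⊤ : ℕ∞) (Function.uncurry f) (slit U)) :
    Represents (SmoothFun.mk _ hf) f := fun _ => rfl

theorem pdy (hU : IsOpen U) {a : SmoothFun (slit U)} {f : Pt n → Pt n → ℝ}
    (h : Represents a f) (i : Fin n) :
    Represents (dirDeriv (isOpen_slit hU) (0, Pi.single i 1) a) (pdy f i) := by
  rintro ⟨⟨x, y⟩, hp⟩
  rw [eval_dirDeriv _ _ h]
  have hd := (differentiableAt_of_eval_eq (isOpen_slit hU) h ⟨(x, y), hp⟩).hasFDerivAt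
  have := HasFDerivAt.comp y hd (hasFDerivAt_prodMk_right x y)
  simp only [Function.uncurry, _root_.pdy]
  rw [show (fun y' => f x y') = Function.uncurry f ∘ fun y' => (x, y') from rfl, this.fderiv]
  simp

theorem pdx (hU : IsOpen U) {a : SmoothFun (slit U)} {f : Pt n → Pt n → ℝ}
    (h : Represents a f) (i : Fin n) :
    Represents (dirDeriv (isOpen_slit hU) (Pi.single i 1, 0) a) (pdx f i) := by
  rintro ⟨⟨x, y⟩, hp⟩
  rw [eval_dirDeriv _ _ h]
  have hd := (differentiableAt_of_eval_eq (isOpen_slit hU) h ⟨(x, y), hp⟩).hasFDerivAt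
  have := HasFDerivAt.comp (f := fun x' => (x', y)) x hd (hasFDerivAt_prodMk_left (𝕜 := ℝ) x y)
  simp only [Function.uncurry, _root_.pdx]
  rw [show (fun x' => f x' y) = Function.uncurry f ∘ fun x' => (x', y) from rfl, this.fderiv]
  simp

end Represents

namespace IsFinslerMetric

open SmoothFun

variable {F : Pt n → Pt n → ℝ} (hF : IsFinslerMetric U F)

/-- The metric as an element of the algebra of smooth functions. -/
noncomputable def toSmooth : SmoothFun (slit U) := SmoothFun.mk (Ω := slit U) (Function.uncurry F) hF.smooth

/-- The fiber coordinates. -/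
noncomputable def coord (U : Set (Pt n)) (i : Fin n) : SmoothFun (slit U) :=
  SmoothFun.mk (fun p => p.2 i) (by fun_prop)

/-- Horizontal coordinate derivations. -/
noncomputable def dX (i : Fin n) : Derivation ℝ (SmoothFun (slit U)) (SmoothFun (slit U)) :=
  dirDeriv (isOpen_slit hF.isOpen) (Pi.single i 1, 0)

/-- Vertical coordinate derivations. -/
noncomputable def dY (i : Fin n) : Derivation ℝ (SmoothFun (slit U)) (SmoothFun (slit U)) :=
  dirDeriv (isOpen_slit hF.isOpen) (0, Pi.single i 1)

theorem dX_coord (i j : Fin n) : hF.dX i (coord U j) = 0 := by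
  refine ext_eval fun p => ?_
  have hd : HasFDerivAt (fun q : Pt n × Pt n => q.2 j)
      ((ContinuousLinearMap.proj j).comp (ContinuousLinearMap.snd ℝ (Pt n) (Pt n))) p.1 :=
    ((ContinuousLinearMap.proj j).comp (ContinuousLinearMap.snd ℝ (Pt n) (Pt n))).hasFDerivAt
  rw [dX, eval_dirDeriv _ _ (φ := fun q => q.2 j) (fun _ => rfl), hd.fderiv]
  simp

theorem dY_coord (i j : Fin n) : hF.dY i (coord U j) = if i = j then 1 else 0 := by
  refine ext_eval fun p => ?_
  have hd : HasFDerivAt (fun q : Pt n × Pt n => q.2 j)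
      ((ContinuousLinearMap.proj j).comp (ContinuousLinearMap.snd ℝ (Pt n) (Pt n))) p.1 :=
    ((ContinuousLinearMap.proj j).comp (ContinuousLinearMap.snd ℝ (Pt n) (Pt n))).hasFDerivAt
  rw [dY, eval_dirDeriv _ _ (φ := fun q => q.2 j) (fun _ => rfl), hd.fderiv]
  by_cases hij : i = j
  · simp [hij]
  · simp [hij, Ne.symm hij]

theorem represents_F2 : Represents (hF.toSmooth * hF.toSmooth) (F2 F) := fun _ =>
  (map_mul _ _ _).trans (sq _).symm

theorem sum_coord_mul_dY : ∑ j, coord U j * hF.dY j hF.toSmooth = hF.toSmooth := by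
  refine ext_eval ?_
  rintro ⟨⟨x, y⟩, hp⟩
  have hd := (differentiableAt_of_eval_eq (isOpen_slit hF.isOpen)
    (Represents.mk hF.smooth) ⟨(x, y), hp⟩).hasFDerivAt
  have h₁ : HasDerivAt (fun t : ℝ => (x, t • y)) ((0 : Pt n), y) 1 := by
    have := ((hasDerivAt_id (1 : ℝ)).smul_const y)
    simpa using (hasDerivAt_const (1 : ℝ) x).prodMk this
  have h₂ : HasDerivAt (fun t : ℝ => Function.uncurry F (x, t • y))
      (fderiv ℝ (Function.uncurry F) (x, y) (0, y)) 1 := by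
    have hd' : HasFDerivAt (Function.uncurry F) (fderiv ℝ (Function.uncurry F) (x, y))
      ((x, (1 : ℝ) • y)) := by simpa using hd
    exact hd'.comp_hasDerivAt (1 : ℝ) h₁
  have h₃ : HasDerivAt (fun t : ℝ => Function.uncurry F (x, t • y)) (F x y) 1 := by
    have : HasDerivAt (fun t : ℝ => t * F x y) (F x y) 1 := by
      simpa using (hasDerivAt_id (1 : ℝ)).mul_const (F x y)
    refine this.congr_of_eventuallyEq ?_
    filter_upwards [lt_mem_nhds (zero_lt_one' ℝ)] with t ht
    exact hF.homog x hp.1 y hp.2 t ht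
  have h₄ : ((0 : Pt n), y) = ∑ j, y j • ((0 : Pt n), (Pi.single j 1 : Pt n)) := by
    ext i
    · simp [Prod.fst_sum]
    · simp [Prod.snd_sum, Finset.sum_apply, Pi.single_apply]
  rw [map_sum]
  simp only [map_mul, dY, eval_dirDeriv _ _ (Represents.mk hF.smooth), toSmooth, coord, eval_mk]
  change ∑ j, y j * fderiv ℝ (Function.uncurry F) (x, y) (0, Pi.single j 1) = F x y
  rw [← h₂.unique h₃]
  conv_rhs => rw [h₄, map_sum]
  simp only [map_smul, smul_eq_mul]

/-- The energy `F² / 2`. -/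
noncomputable def energy : SmoothFun (slit U) := (1 / 2 : ℝ) • (hF.toSmooth * hF.toSmooth)

theorem two_mul_energy : 2 * hF.energy = hF.toSmooth * hF.toSmooth := by
  rw [energy, mul_smul_comm, two_mul, ← two_smul ℝ, smul_smul]
  norm_num

theorem represents_gLow (i j : Fin n) :
    Represents (hF.dY i (hF.dY j hF.energy)) (gLow F i j) := fun p => by
  have h := ((hF.represents_F2.pdy hF.isOpen j).pdy hF.isOpen i) p
  rw [energy, Derivation.map_smul, Derivation.map_smul, map_smul, dY, dY, h]
  rfl

theorem eval_map_g (p : slit U) :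
    (Matrix.of fun i j => hF.dY i (hF.dY j hF.energy)).map (eval p) = gMat F p.1.1 p.1.2 := by
  ext i j
  exact hF.represents_gLow i j p

/-- The calculus attached to a Finsler metric. -/
noncomputable def calculus : FinslerCalculus (SmoothFun (slit U)) (Fin n) where
  dx := hF.dX
  dy := hF.dY
  y := coord U
  E := hF.energy
  dx_dx _ _ := dirDeriv_comm _ _ _
  dy_dy _ _ := dirDeriv_comm _ _ _
  dx_dy _ _ := dirDeriv_comm _ _ _
  dx_y := hF.dX_coord
  dy_y := hF.dY_coord
  euler_E := by
    have h : ∀ j, hF.dY j hF.energy = hF.toSmooth * hF.dY j hF.toSmooth := fun j => by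
      apply two_mul_cancel_of_algebra
      have := congrArg (hF.dY j) hF.two_mul_energy
      rw [Derivation.map_mul_eq, Derivation.map_mul_eq, Derivation.map_two] at this
      linear_combination this
    have h' : ∑ j, coord U j * hF.dY j hF.energy
        = hF.toSmooth * ∑ j, coord U j * hF.dY j hF.toSmooth := by
      rw [Finset.mul_sum]
      exact Finset.sum_congr rfl fun j _ => by rw [h]; ring
    rw [h', sum_coord_mul_dY, two_mul_energy]
  isUnit_det := isUnit_of_eval_ne_zero fun p => by
    rw [← AlgHom.coe_toRingHom, RingHom.map_det, RingHom.mapMatrix_apply]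
    exact (hF.eval_map_g p).symm ▸ (hF.posdef _ p.2.1 _ p.2.2).det_pos.ne'

theorem represents_gInv (i j : Fin n) : Represents (hF.calculus.g⁻¹ i j) (gInv F i j) := fun p => by
  have h : gMat F p.1.1 p.1.2 * (hF.calculus.g⁻¹).map (eval p) = 1 := by
    rw [← hF.eval_map_g p]
    change hF.calculus.g.map (eval p) * _ = 1
    have := congrArg (fun M => M.map (eval p))
      (Matrix.mul_nonsing_inv _ hF.calculus.isUnit_det_g)
    simpa [Matrix.map_mul, Matrix.map_one] using this
  change _ = (gMat F p.1.1 p.1.2)⁻¹ i j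
  rw [Matrix.inv_eq_right_inv h]
  rfl

theorem represents_Gspray (i : Fin n) : Represents (hF.calculus.G i) (Gspray F i) := fun p => by
  have h₁ : ∀ l, eval p (hF.dX l hF.energy) = 1 / 2 * pdx (F2 F) l p.1.1 p.1.2 := fun l => by
    rw [energy, Derivation.map_smul, map_smul, dX, (hF.represents_F2.pdx hF.isOpen l) p]; rfl
  have h₂ : ∀ k l, eval p (hF.dX k (hF.dY l hF.energy))
      = 1 / 2 * pdx (pdy (F2 F) l) k p.1.1 p.1.2 := fun k l => by
    rw [energy, Derivation.map_smul, Derivation.map_smul, map_smul, dX, dY,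
      ((hF.represents_F2.pdy hF.isOpen l).pdx hF.isOpen k) p]; rfl
  rw [FinslerCalculus.G, map_smul, map_sum]
  simp only [map_mul, map_sub, map_sum, hF.represents_gInv _ _ p]
  simp only [calculus, h₁, h₂, Function.uncurry, Gspray, coord, eval_mk, smul_eq_mul,
    Finset.mul_sum]
  refine Finset.sum_congr rfl fun l _ => ?_
  have : ∑ k, p.1.2 k * (1 / 2 * pdx (pdy (F2 F) l) k p.1.1 p.1.2)
      = 1 / 2 * ∑ k, p.1.2 k * pdx (pdy (F2 F) l) k p.1.1 p.1.2 := by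
    rw [Finset.mul_sum]; exact Finset.sum_congr rfl fun _ _ => by ring
  rw [this]
  ring

theorem represents_Ncon (i j : Fin n) : Represents (hF.calculus.N i j) (Ncon F i j) :=
  (hF.represents_Gspray i).pdy hF.isOpen j

theorem represents_Γcon (i j k : Fin n) : Represents (hF.calculus.Γ j i k) (Γcon F i j k) :=
  (hF.represents_Ncon i k).pdy hF.isOpen j

theorem represents_Bcurv (i j k l : Fin n) :
    Represents (hF.dY j (hF.dY k (hF.dY l (hF.calculus.G i)))) (Bcurv F i j k l) :=
  (((hF.represents_Gspray i).pdy hF.isOpen l).pdy hF.isOpen k).pdy hF.isOpen j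

theorem represents_RiemK (i k : Fin n) : Represents (hF.calculus.R i k) (RiemK F i k) := fun p => by
  have hx := (hF.represents_Gspray i).pdx hF.isOpen k p
  have hNx : ∀ j, eval p (hF.dX j (hF.calculus.N i k))
      = pdx (pdy (Gspray F i) k) j p.1.1 p.1.2 := fun j =>
    (hF.represents_Ncon i k).pdx hF.isOpen j p
  have hΓ : ∀ j, eval p (hF.dY j (hF.calculus.N i k)) = Γcon F i j k p.1.1 p.1.2 := fun j =>
    hF.represents_Γcon i j k p
  have hN : ∀ i j, eval p (hF.calculus.N i j) = Ncon F i j p.1.1 p.1.2 := fun i j =>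
    hF.represents_Ncon i j p
  have hG : ∀ j, eval p (hF.calculus.G j) = Gspray F j p.1.1 p.1.2 := fun j =>
    hF.represents_Gspray j p
  change eval p (2 * hF.dX k (hF.calculus.G i) - hF.calculus.S (hF.calculus.N i k)
    - ∑ j, hF.calculus.N i j * hF.calculus.N j k) = _
  rw [FinslerCalculus.S_apply]
  change eval p (2 * hF.dX k (hF.calculus.G i) - (∑ j, coord U j * hF.dX j (hF.calculus.N i k)
    - ∑ r, 2 * hF.calculus.G r * hF.dY r (hF.calculus.N i k)) - _) = _
  simp only [map_sub, map_sum, map_mul, hNx, hΓ, hN, hG, map_ofNat]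
  rw [dX, hx]
  simp only [Function.uncurry, RiemK, coord, eval_mk, mul_assoc, ← Finset.mul_sum]
  ring

theorem eval_c (p : slit U) (j k l : Fin n) :
    eval p (hF.calculus.c j k l) = 2 * Cartan F j k l p.1.1 p.1.2 := by
  have h := (((hF.represents_F2.pdy hF.isOpen l).pdy hF.isOpen k).pdy hF.isOpen j) p
  change eval p (hF.dY j (hF.dY k (hF.dY l hF.energy))) = _
  rw [energy, Derivation.map_smul, Derivation.map_smul, Derivation.map_smul, map_smul, dY, dY, dY,
    h]
  simp only [Function.uncurry, Cartan, smul_eq_mul]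
  ring

theorem eval_dY_energy (p : slit U) (j : Fin n) :
    eval p (hF.dY j hF.energy) = yLow F j p.1.1 p.1.2 := by
  have h := congrArg (eval p) (hF.calculus.sum_y_mul_g j)
  rw [map_sum] at h
  refine h.symm.trans (Finset.sum_congr rfl fun i _ => ?_)
  rw [hF.calculus.g_symm, map_mul, mul_comm]
  congr 1
  exact hF.represents_gLow j i p

theorem eval_S (p : slit U) {a : SmoothFun (slit U)} {f : Pt n → Pt n → ℝ} (h : Represents a f) :
    eval p (hF.calculus.S a) = ∑ s, hD0 F f s p.1.1 p.1.2 * p.1.2 s := by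
  have hy : ∀ r, ∑ k, p.1.2 k * Ncon F r k p.1.1 p.1.2 = 2 * Gspray F r p.1.1 p.1.2 := fun r => by
    have h := congrArg (eval p) (hF.calculus.sum_y_mul_N r)
    simp only [map_sum, map_mul, map_ofNat, hF.represents_Ncon _ _ p,
      hF.represents_Gspray _ p] at h
    exact h
  have hx : ∀ k, eval p (hF.dX k a) = pdx f k p.1.1 p.1.2 := fun k => h.pdx hF.isOpen k p
  have hv : ∀ k, eval p (hF.dY k a) = pdy f k p.1.1 p.1.2 := fun k => h.pdy hF.isOpen k p
  rw [FinslerCalculus.S_apply]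
  simp only [map_sub, map_sum, map_mul, map_ofNat, hF.represents_Gspray _ p, Function.uncurry,
    ← hy, hD0, sub_mul, Finset.sum_sub_distrib, Finset.sum_mul]
  change ∑ k, p.1.2 k * eval p (hF.dX k a)
    - ∑ r, ∑ k, p.1.2 k * Ncon F r k p.1.1 p.1.2 * eval p (hF.dY r a) = _
  simp only [hx, hv]
  rw [Finset.sum_comm]
  congr 1
  · exact Finset.sum_congr rfl fun _ _ => mul_comm _ _
  · exact Finset.sum_congr rfl fun _ _ => Finset.sum_congr rfl fun _ _ => by ring

end IsFinslerMetric

theorem IsGIB.mul_cartan_eq_zero {F μ lam K : Pt n → Pt n → ℝ} (hF : IsGIB U F μ lam)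
    (hK : IsScalarFlagCurv U F K)
    (hiso : ∀ x ∈ U, ∀ y y' : Pt n, y ≠ 0 → y' ≠ 0 → K x y = K x y')
    {x : Pt n} (hx : x ∈ U) {y : Pt n} (hy : y ≠ 0) (j k l : Fin n) :
    (2 * (∑ s, hD0 F μ s x y * y s) - ((μ x y) ^ 2 + 4 * K x y) * F x y)
      * Cartan F j k l x y = 0 := by
  have hf := hF.finsler
  set C := hf.calculus
  have hu : IsUnit hf.toSmooth :=
    SmoothFun.isUnit_of_eval_ne_zero fun p => (hf.pos _ p.2.1 _ p.2.2).ne'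
  obtain ⟨f, hFf⟩ := hu.exists_right_inv
  have hfe : ∀ p, SmoothFun.eval p f = (F p.1.1 p.1.2)⁻¹ := fun p => by
    have := congrArg (SmoothFun.eval p) hFf
    rw [map_mul, map_one] at this
    exact eq_inv_of_mul_eq_one_right this
  have hE : ∀ p, 2 * SmoothFun.eval p hf.energy = F p.1.1 p.1.2 ^ 2 := fun p => by
    have := congrArg (SmoothFun.eval p) hf.two_mul_energy
    rw [map_mul, map_ofNat] at this
    exact this.trans (hf.represents_F2 p)
  have hite : ∀ (p : slit U) (i j : Fin n),
      SmoothFun.eval p (if i = j then 1 else 0) = if i = j then 1 else 0 := fun p i j => by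
    split_ifs <;> simp
  obtain ⟨m, hm⟩ : ∃ m : SmoothFun (slit U), Represents m μ := ⟨_, Represents.mk hF.smooth_mu⟩
  obtain ⟨la, hla⟩ : ∃ la : SmoothFun (slit U), Represents la lam :=
    ⟨_, Represents.mk hF.smooth_lam⟩
  obtain ⟨κ, hκ⟩ : ∃ κ : SmoothFun (slit U), Represents κ K := ⟨_, Represents.mk hK.1⟩
  have key := FinslerCalculus.gib_mul_c_eq_zero (C := C) (F := hf.toSmooth) (f := f)
    (K := κ) (μ := m) (lam := la) hf.two_mul_energy.symm hFf ?_ ?_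
    (fun k l => C.g k l - hf.dY k hf.energy * hf.dY l hf.energy * f ^ 2) ?_ j k l
  · have h := congrArg (SmoothFun.eval (⟨(x, y), hx, hy⟩ : slit U)) key
    rw [map_mul, hf.eval_c, map_zero] at h
    simp only [map_sub, map_mul, map_add, map_pow, map_ofNat,
      hf.eval_S _ hm, hm _, hκ _, C] at h
    change (2 * (∑ s, hD0 F μ s x y * y s) - ((μ x y) ^ 2 + 4 * K x y) * F x y)
      * (2 * Cartan F j k l x y) = 0 at h
    linear_combination h / 2
  · intro i
    refine SmoothFun.ext_eval ?_
    rintro ⟨⟨x, y⟩, hp⟩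
    refine (hκ.pdy hf.isOpen i _).trans ?_
    have : (fun y' => K x y') =ᶠ[nhds y] fun _ => K x y := by
      filter_upwards [isOpen_ne.mem_nhds hp.2] with y' hy'
      exact hiso x hp.1 _ _ hy' hp.2
    simp [Function.uncurry, pdy, this.fderiv_eq]
  · intro i k
    refine SmoothFun.ext_eval fun p => ?_
    rw [hf.represents_RiemK]
    have h := hK.2 _ p.2.1 _ p.2.2 i k
    refine h.trans ?_
    have hF0 := (hf.pos _ p.2.1 _ p.2.2).ne'
    change _ = SmoothFun.eval p (κ * (2 * hf.energy * (if i = k then 1 else 0)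
      - IsFinslerMetric.coord U i * hf.dY k hf.energy))
    simp only [map_mul, map_sub, map_ofNat, hκ p, hE, hite, hf.eval_dY_energy, SmoothFun.eval_mk,
      IsFinslerMetric.coord, hUp, Function.uncurry]
    field_simp
  · intro i j k l
    refine SmoothFun.ext_eval fun p => ?_
    have hF0 := (hf.pos _ p.2.1 _ p.2.2).ne'
    have hg : ∀ i j, SmoothFun.eval p (C.g i j) = gLow F i j p.1.1 p.1.2 := fun i j =>
      hf.represents_gLow i j p
    have hdy : ∀ j, SmoothFun.eval p (C.dy j C.E) = yLow F j p.1.1 p.1.2 := hf.eval_dY_energy p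
    have hy : SmoothFun.eval p (C.y i) = p.1.2 i := rfl
    have hBr : SmoothFun.eval p (C.dy j (C.dy k (C.dy l (C.G i)))) = Bcurv F i j k l p.1.1 p.1.2 :=
      hf.represents_Bcurv i j k l p
    have hc : SmoothFun.eval p (C.c j k l) = 2 * Cartan F j k l p.1.1 p.1.2 := hf.eval_c p j k l
    simp only [map_mul, map_add, map_sub, map_pow, map_ofNat, hBr, hc, hdy, hy, hg, hite,
      hfe, hf.eval_dY_energy, hm p, hla p]
    rw [hF.berwald _ p.2.1 _ p.2.2]
    simp only [Function.uncurry, hUp, hLow, ell]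
    field_simp

end Slit

/-- **Corollary.** A generalized isotropic Berwald metric of isotropic flag curvature
`K = K(x)` with `2μ' - (μ² + 4K)F ≠ 0` everywhere has vanishing mean Cartan torsion,
hence is Riemannian. -/
theorem gib_isotropic_flag_curvature_riemannian {n : ℕ} (U : Set (Pt n))
    (F μ lam K : Pt n → Pt n → ℝ) (hF : IsGIB U F μ lam)
    (hK : IsScalarFlagCurv U F K)
    (hiso : ∀ x ∈ U, ∀ y y' : Pt n, y ≠ 0 → y' ≠ 0 → K x y = K x y')
    (hne : ∀ x ∈ U, ∀ y : Pt n, y ≠ 0 →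
      2 * (∑ s, hD0 F μ s x y * y s) - ((μ x y) ^ 2 + 4 * K x y) * F x y ≠ 0) :
    ∀ x ∈ U, ∀ y : Pt n, y ≠ 0 → ∀ k : Fin n, mCartan F k x y = 0 := by
  intro x hx y hy k
  have hC : ∀ i j k, Cartan F i j k x y = 0 := fun i j k =>
    (mul_eq_zero.1 (hF.mul_cartan_eq_zero hK hiso hx hy i j k)).resolve_left (hne x hx y hy)
  simp [mCartan, hC]
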